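/- Let R be a commutative ring, A a commutative R-algebra, and ε : A → R an R-linear map. Suppose (u_i, v_i), i = 1,…,r, and (u'_j, v'_j), j = 1,…,s, are two Frobenius systems with the same counit ε, i.e. each family satisfies the symmetry condition in A ⊗_R A and, for every a ∈ A, a = ∑_i ε(a·u_i)·v_i = ∑_i ε(a·v_i)·u_i and a = ∑_j ε(a·u'_j)·v'_j = ∑_j ε(a·v'_j)·u'_j. Then ∑_{i=1}^r u_i ⊗ v_i = ∑_{j=1}^s u'_j ⊗ v'_j in A ⊗_R A, and consequently the rank is well-defined: ∑_{i=1}^r ε(u_i·v_i) = ∑_{j=1}^s ε(u'_j·v'_j) in R. -/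

import Mathlib

open TensorProduct

/-- A right dual family `(u, v)` and a left dual family `(u', v')` for the same linear form `ε`
define the same element of `A ⊗[R] A`. -/
theorem sum_tmul_eq_sum_tmul_of_dual {R A ι κ : Type*} [CommRing R] [CommRing A] [Algebra R A]
    [Fintype ι] [Fintype κ] (ε : A →ₗ[R] R) (u v : ι → A) (u' v' : κ → A)
    (h : ∀ a : A, a = ∑ i, ε (a * u i) • v i) (h' : ∀ a : A, a = ∑ j, ε (a * v' j) • u' j) :
    ∑ i, u i ⊗ₜ[R] v i = ∑ j, u' j ⊗ₜ[R] v' j :=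
  calc
    ∑ i, u i ⊗ₜ[R] v i = ∑ i, (∑ j, ε (u i * v' j) • u' j) ⊗ₜ[R] v i :=
      Finset.sum_congr rfl fun i _ => by rw [← h' (u i)]
    _ = ∑ j, u' j ⊗ₜ[R] (∑ i, ε (v' j * u i) • v i) := by
      simp only [sum_tmul, tmul_sum, smul_tmul, mul_comm (u _)]
      exact Finset.sum_comm
    _ = ∑ j, u' j ⊗ₜ[R] v' j :=
      Finset.sum_congr rfl fun j _ => by rw [← h (v' j)]

/-- Two Frobenius systems with the same counit `ε` have the same
element `Δ(1) = ∑ u i ⊗ v i` in `A ⊗[R] A`, and consequently the same rank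
`∑ ε (u i * v i)`. -/
theorem frobenius_system_delta_one_and_rank_well_defined
    (R A : Type*) [CommRing R] [CommRing A] [Algebra R A]
    (ε : A →ₗ[R] R) (r s : ℕ) (u v : Fin r → A) (u' v' : Fin s → A)
    (hsym : ∑ i, u i ⊗ₜ[R] v i = ∑ i, v i ⊗ₜ[R] u i)
    (hcounit₁ : ∀ a : A, a = ∑ i, ε (a * u i) • v i)
    (hcounit₂ : ∀ a : A, a = ∑ i, ε (a * v i) • u i)
    (hsym' : ∑ j, u' j ⊗ₜ[R] v' j = ∑ j, v' j ⊗ₜ[R] u' j)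
    (hcounit₁' : ∀ a : A, a = ∑ j, ε (a * u' j) • v' j)
    (hcounit₂' : ∀ a : A, a = ∑ j, ε (a * v' j) • u' j) :
    (∑ i, u i ⊗ₜ[R] v i) = (∑ j, u' j ⊗ₜ[R] v' j) ∧
      (∑ i, ε (u i * v i)) = (∑ j, ε (u' j * v' j)) := by
  have h := sum_tmul_eq_sum_tmul_of_dual ε u v u' v' hcounit₁ hcounit₂'
  refine ⟨h, ?_⟩
  simpa using congrArg (ε ∘ₗ LinearMap.mul' R A) h
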